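/- Let x > 0, let C be a convex set of nonnegative random variables containing the constant random variable x, and let U : [0,∞) → ℝ ∪ {−∞} be nondecreasing with U(x/2) > −∞ and lim_{y→∞} U(y) = ∞. If C is not bounded in probability, then sup_{f ∈ C} E[U(f)] = ∞; indeed, there exist f_n ∈ C with f_n ≥ x/2 a.s. for every n and lim_{n→∞} E[U(f_n)] = ∞. -/

import Mathlib

open MeasureTheory Set Filter
open scoped NNReal ENNReal Topology

noncomputable section

/-- A set of random variables is bounded in probability. -/
def BddInProb {Ω : Type*} [MeasurableSpace Ω] (P : MeasureTheory.Measure Ω)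
    (C : Set (Ω → ℝ)) : Prop :=
  Filter.Tendsto (fun ℓ : ℝ => ⨆ f ∈ C, P {ω | ℓ < |f ω|}) Filter.atTop (nhds 0)

/-- Auxiliary: the nonnegative part of an extended real, valued in `ℝ≥0∞`. -/
def erealPosPart (x : EReal) : ℝ≥0∞ := if x = ⊤ then ⊤ else ENNReal.ofReal x.toReal

/-- The extended expectation `E[g] ∈ [−∞, ∞]` of an `EReal`-valued random variable, with the
convention that it equals `−∞` whenever the negative part fails to be integrable. -/
def extExp {Ω : Type*} [MeasurableSpace Ω] (P : MeasureTheory.Measure Ω) (g : Ω → EReal) :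
    EReal :=
  ((∫⁻ ω, erealPosPart (g ω) ∂P : ℝ≥0∞) : EReal) -
    ((∫⁻ ω, erealPosPart (-(g ω)) ∂P : ℝ≥0∞) : EReal)

lemma erealPosPart_mono' : Monotone erealPosPart := fun _ _ h => EReal.toENNReal_le_toENNReal h

/-- Lower bound on the extended expectation. -/
lemma extExp_lower {Ω : Type*} {m : MeasurableSpace Ω} (P : MeasureTheory.Measure Ω)
    [MeasureTheory.IsProbabilityMeasure P] (g : Ω → EReal) (k : EReal) (c ε : ℝ≥0∞)
    (S : Set Ω) (hS : MeasurableSet S) (hPS : ε ≤ P S)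
    (h1 : ∀ᵐ ω ∂P, k ≤ g ω) (h2 : ∀ᵐ ω ∂P, ω ∈ S → (c : EReal) ≤ g ω) :
    ((c * ε : ℝ≥0∞) : EReal) - (erealPosPart (-k) : EReal) ≤ extExp P g := by
  unfold extExp
  apply EReal.sub_le_sub
  · rw [EReal.coe_ennreal_le_coe_ennreal_iff]
    calc c * ε ≤ c * P S := by gcongr
      _ = ∫⁻ ω, S.indicator (fun _ => c) ω ∂P := (lintegral_indicator_const hS c).symm
      _ ≤ _ := by
        apply lintegral_mono_ae
        filter_upwards [h2] with ω hω
        by_cases h : ω ∈ S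
        · rw [indicator_of_mem h]
          have := erealPosPart_mono' (hω h)
          refine le_trans (le_of_eq ?_) this
          exact (EReal.toENNReal_coe).symm
        · rw [indicator_of_notMem h]; exact zero_le
  · rw [EReal.coe_ennreal_le_coe_ennreal_iff]
    calc _ ≤ ∫⁻ _, erealPosPart (-k) ∂P := by
          apply lintegral_mono_ae
          filter_upwards [h1] with ω hω
          exact erealPosPart_mono' (EReal.neg_le_neg_iff.2 hω)
      _ = _ := by simp

/-- **Abstract argument behind Proposition 3.1.** Let `C` be a convex set of nonnegative random
variables containing the constant `x > 0`, and `U : [0,∞) → ℝ ∪ {−∞}` nondecreasing with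
`U(x/2) > −∞` and `U(∞) = ∞`. If `C` is not bounded in probability then the supremum of
`E[U(f)]` over `f ∈ C` is `∞`; indeed there are `f_n ∈ C` with `f_n ≥ x/2` a.s. and
`E[U(f_n)] → ∞`. -/
theorem unbounded_utility_of_not_bddInProb
    {Ω : Type*} {m : MeasurableSpace Ω} (P : MeasureTheory.Measure Ω)
    [MeasureTheory.IsProbabilityMeasure P]
    (x : ℝ) (hx : 0 < x) (C : Set (Ω → ℝ))
    (hC_meas : ∀ f ∈ C, Measurable f)
    (hC_nonneg : ∀ f ∈ C, ∀ᵐ ω ∂P, 0 ≤ f ω)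
    (hC_const : (fun _ => x) ∈ C)
    (hC_convex : ∀ f ∈ C, ∀ g ∈ C, ∀ a b : ℝ, 0 ≤ a → 0 ≤ b → a + b = 1 →
      (fun ω => a * f ω + b * g ω) ∈ C)
    (U : ℝ → EReal)
    (hU_mono : ∀ a b : ℝ, 0 ≤ a → a ≤ b → U a ≤ U b)
    (hU_half : U (x / 2) ≠ ⊥)
    (hU_ne_top : ∀ y : ℝ, U y ≠ ⊤)
    (hU_infty : Filter.Tendsto U Filter.atTop (nhds (⊤ : EReal)))
    (hC_unbdd : ¬ BddInProb P C) :
    (⨆ f ∈ C, extExp P (fun ω => U (f ω))) = ⊤ ∧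
      ∃ fs : ℕ → Ω → ℝ, (∀ n, fs n ∈ C) ∧ (∀ n, ∀ᵐ ω ∂P, x / 2 ≤ fs n ω) ∧
        Filter.Tendsto (fun n => extExp P (fun ω => U (fs n ω))) Filter.atTop
          (nhds (⊤ : EReal)) := by
  have key : ∃ fs : ℕ → Ω → ℝ, (∀ n, fs n ∈ C) ∧ (∀ n, ∀ᵐ ω ∂P, x / 2 ≤ fs n ω) ∧
        Filter.Tendsto (fun n => extExp P (fun ω => U (fs n ω))) Filter.atTop
          (nhds (⊤ : EReal)) := by
    unfold BddInProb at hC_unbdd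
    rw [ENNReal.tendsto_nhds_zero] at hC_unbdd
    push Not at hC_unbdd
    obtain ⟨ε, hε, hfreq⟩ := hC_unbdd
    have step : ∀ n : ℕ, ∃ f ∈ C, (∀ᵐ ω ∂P, x / 2 ≤ f ω) ∧
        ((((n : ℝ≥0∞) * ε : ℝ≥0∞) : EReal) - (erealPosPart (-(U (x/2))) : EReal)
          ≤ extExp P (fun ω => U (f ω))) := by
      intro n
      have hev : ∀ᶠ y in atTop, (((n : ℝ≥0∞)) : EReal) < U y := by
        apply hU_infty.eventually_const_lt
        rw [lt_top_iff_ne_top]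
        simp
      obtain ⟨y, hy, hy0⟩ := (hev.and (eventually_ge_atTop 0)).exists
      obtain ⟨l, hl, hly⟩ := (hfreq.and_eventually (eventually_ge_atTop (2 * y))).exists
      simp only [lt_iSup_iff] at hl
      obtain ⟨f, hf, hfl⟩ := hl
      refine ⟨_, hC_convex _ hC_const f hf (1/2) (1/2) (by norm_num) (by norm_num) (by norm_num),
        ?_, ?_⟩
      · filter_upwards [hC_nonneg f hf] with ω h0
        linarith
      · refine extExp_lower P _ (U (x/2)) n ε {ω | l < |f ω|}
          (measurableSet_lt measurable_const (hC_meas f hf).abs) hfl.le ?_ ?_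
        · filter_upwards [hC_nonneg f hf] with ω h0
          exact hU_mono _ _ (by linarith) (by linarith)
        · filter_upwards [hC_nonneg f hf] with ω h0 hω
          rw [abs_of_nonneg h0] at hω
          exact hy.le.trans (hU_mono _ _ hy0 (by linarith))
    choose fs h1 h2 h3 using step
    refine ⟨fs, h1, h2, ?_⟩
    have hK : erealPosPart (-(U (x/2))) ≠ ⊤ := by
      unfold erealPosPart
      rw [if_neg (by simpa using hU_half)]
      exact ENNReal.ofReal_ne_top
    have hK' : (erealPosPart (-(U (x/2))) : EReal) ≠ ⊤ := by simpa using hK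
    have hT : Tendsto (fun n : ℕ => (((n : ℝ≥0∞) * ε : ℝ≥0∞) : EReal)) atTop (𝓝 ⊤) := by
      have := ENNReal.Tendsto.mul_const (b := ε) ENNReal.tendsto_nat_nhds_top (Or.inl ENNReal.top_ne_zero)
      rw [ENNReal.top_mul hε.ne'] at this
      exact EReal.tendsto_coe_ennreal.2 this
    rw [EReal.tendsto_nhds_top_iff_real]
    intro r
    have hlt : (r : EReal) + (erealPosPart (-(U (x/2))) : EReal) < ⊤ :=
      EReal.add_lt_top (EReal.coe_ne_top r) hK'
    filter_upwards [hT.eventually_const_lt hlt] with n hn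
    refine lt_of_lt_of_le ?_ (h3 n)
    exact (EReal.lt_sub_iff_add_lt (Or.inl (EReal.coe_ennreal_ne_bot _)) (Or.inl hK')).2 hn
  refine ⟨?_, key⟩
  obtain ⟨fs, h1, -, h3⟩ := key
  rw [eq_top_iff]
  exact le_of_tendsto' h3 fun n => le_iSup₂ (f := fun f (_ : f ∈ C) => extExp P (fun ω => U (f ω))) (fs n) (h1 n)

end
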